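/- For every integer n ≥ 1 and d = 3n+2, there exists a unique symmetric ℂ-quadrilinear map Ψ : V(d)⁴ → V(8) such that Ψ(l₁^d, l₂^d, l₃^d, l₄^d) = I(l₁,l₂,l₃,l₄)^n · l₁²l₂²l₃²l₄² for all linear forms l₁, l₂, l₃, l₄ ∈ ℂ[x₁,x₂,x₃]. -/

import Mathlib

open MvPolynomial

noncomputable section

/-- The polynomial ring ℂ[x₁,x₂,x₃]. -/
abbrev MvP : Type := MvPolynomial (Fin 3) ℂ

/-- The linear form a₁x₁+a₂x₂+a₃x₃ with coefficient vector a. -/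
def lin (a : Fin 3 → ℂ) : MvP := ∑ i, C (a i) * X i

lemma lin_hom (a : Fin 3 → ℂ) : (lin a).IsHomogeneous 1 := by
  unfold lin
  apply IsHomogeneous.sum
  intro i _
  simpa using (isHomogeneous_C (Fin 3) (a i)).mul (isHomogeneous_X ℂ i)

/-- V(k): the space of homogeneous polynomials of degree k in ℂ[x₁,x₂,x₃]. -/
def V (k : ℕ) : Submodule ℂ MvP := homogeneousSubmodule (Fin 3) ℂ k

/-- l^d as an element of V(d), where l is the linear form with coefficient vector a. -/
def powV (d : ℕ) (a : Fin 3 → ℂ) : V d :=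
  ⟨lin a ^ d, by rw [V, mem_homogeneousSubmodule]; simpa using (lin_hom a).pow d⟩

/-- The bracket (l₁l₂l₃) = det(vec l₁, vec l₂, vec l₃). -/
def br (a b c : Fin 3 → ℂ) : ℂ := Matrix.det (Matrix.of ![a, b, c])

/-- I(l₁,l₂,l₃,l₄) = (l₁l₂l₃)(l₁l₂l₄)(l₁l₃l₄)(l₂l₃l₄). -/
def Icov (a b c d : Fin 3 → ℂ) : ℂ := br a b c * br a b d * br a c d * br b c d

/-- l₁l₂l₃l₄ as an element of V(4). -/
def prod4 (a b c d : Fin 3 → ℂ) : V 4 :=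
  ⟨lin a * lin b * lin c * lin d, by
    rw [V, mem_homogeneousSubmodule]
    simpa using (((lin_hom a).mul (lin_hom b)).mul (lin_hom c)).mul (lin_hom d)⟩

/-- l₁²l₂²l₃²l₄² as an element of V(8). -/
def prod4sq (a b c d : Fin 3 → ℂ) : V 8 :=
  ⟨lin a ^ 2 * lin b ^ 2 * lin c ^ 2 * lin d ^ 2, by
    rw [V, mem_homogeneousSubmodule]
    simpa using ((((lin_hom a).pow 2).mul ((lin_hom b).pow 2)).mul ((lin_hom c).pow 2)).mul
      ((lin_hom d).pow 2)⟩

/-- Φ is a Clebsch covariant of degree d = 3n+1: a symmetric quadrilinear map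
V(d)⁴ → V(4) with Φ(l₁^d,l₂^d,l₃^d,l₄^d) = I(l₁,l₂,l₃,l₄)^n · l₁l₂l₃l₄. -/
def IsClebschS (n : ℕ) (Φ : MultilinearMap ℂ (fun _ : Fin 4 => V (3*n+1)) (V 4)) : Prop :=
  (∀ (v : Fin 4 → V (3*n+1)) (σ : Equiv.Perm (Fin 4)), Φ (v ∘ σ) = Φ v) ∧
  (∀ a b c d : Fin 3 → ℂ,
    Φ ![powV (3*n+1) a, powV (3*n+1) b, powV (3*n+1) c, powV (3*n+1) d]
      = (Icov a b c d) ^ n • prod4 a b c d)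

/-- Ψ is a Clebsch covariant of degree d = 3n+2: a symmetric quadrilinear map
V(d)⁴ → V(8) with Ψ(l₁^d,l₂^d,l₃^d,l₄^d) = I(l₁,l₂,l₃,l₄)^n · l₁²l₂²l₃²l₄². -/
def IsClebschT (n : ℕ) (Ψ : MultilinearMap ℂ (fun _ : Fin 4 => V (3*n+2)) (V 8)) : Prop :=
  (∀ (v : Fin 4 → V (3*n+2)) (σ : Equiv.Perm (Fin 4)), Ψ (v ∘ σ) = Ψ v) ∧
  (∀ a b c d : Fin 3 → ℂ,
    Ψ ![powV (3*n+2) a, powV (3*n+2) b, powV (3*n+2) c, powV (3*n+2) d]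
      = (Icov a b c d) ^ n • prod4sq a b c d)

/-- Membership in L_S = x₁^{2n+3}·V(n−2): a homogeneous form of degree 3n+1 lies in L_S
iff it is divisible by x₁^{2n+3}. -/
def memLS (n : ℕ) (h : V (3*n+1)) : Prop := (X 0 : MvP) ^ (2*n+3) ∣ (h : MvP)

/-- Membership in L_T = x₁^{2n+5}·V(n−3): a homogeneous form of degree 3n+2 lies in L_T
iff it is divisible by x₁^{2n+5}. -/
def memLT (n : ℕ) (h : V (3*n+2)) : Prop := (X 0 : MvP) ^ (2*n+5) ∣ (h : MvP)

/-- The Lagrange interpolation polynomial p_i^b of degree K−1 evaluated at c. -/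
def interp {K : ℕ} (b : Fin K → ℂ) (i : Fin K) (c : ℂ) : ℂ :=
  ∏ j ∈ Finset.univ.erase i, (c - b j) / (b i - b j)

/-- f(c) = Σᵢ p_i^b(c)·l_i^d − (cx₁+y)^d where y = λx₂+μx₃ and l_i = b_i x₁ + y. -/
def fc {K : ℕ} (d : ℕ) (b : Fin K → ℂ) (lam mu c : ℂ) : MvP :=
  ∑ i, C (interp b i c) * lin ![b i, lam, mu] ^ d - lin ![c, lam, mu] ^ d

/-- f(c) as an element of V(d). -/
def fcV {K : ℕ} (d : ℕ) (b : Fin K → ℂ) (lam mu c : ℂ) : V d :=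
  ∑ i, interp b i c • powV d ![b i, lam, mu] - powV d ![c, lam, mu]

/-- The bracket (l₁l₂l₃) over an arbitrary commutative ring. -/
def brR {R : Type*} [CommRing R] (a b c : Fin 3 → R) : R := Matrix.det (Matrix.of ![a, b, c])

/-- I(l₁,l₂,l₃,l₄) over an arbitrary commutative ring. -/
def IcovR {R : Type*} [CommRing R] (a b c d : Fin 3 → R) : R :=
  brR a b c * brR a b d * brR a c d * brR b c d

/-- The binomial coefficient polynomial X(X−1)⋯(X−m+1)/m! over ℂ. -/
def binomPoly (m : ℕ) : Polynomial ℂ :=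
  Polynomial.C ((m.factorial : ℂ))⁻¹ * ∏ i ∈ Finset.range m, (Polynomial.X - Polynomial.C (i : ℂ))

/-- The mod-p binomial coefficient polynomial X(X−1)⋯(X−m+1)/m!. -/
def binomPolyZMod (p m : ℕ) : Polynomial (ZMod p) :=
  Polynomial.C ((m.factorial : ZMod p))⁻¹ *
    ∏ i ∈ Finset.range m, (Polynomial.X - Polynomial.C (i : ZMod p))

/-- c·x₁ + λx₂ + μx₃ as an element of (ℂ[x₁,x₂,x₃])[c]. -/
def cLin (lam mu : ℂ) : Polynomial MvP :=
  Polynomial.X * Polynomial.C (X 0) + Polynomial.C (C lam * X 1 + C mu * X 2)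

/-- G_n = −24 Σ_{i<k<p} I(cx₁+y, m_i, m_k, m_p)^n·(cx₁+y)·m_i m_k m_p ∈ ℂ[c,x₁,x₂,x₃],
viewed as a polynomial in c with coefficients in ℂ[x₁,x₂,x₃]. -/
def Gpoly {N : ℕ} (m : Fin N → Fin 3 → ℂ) (lam mu : ℂ) (n : ℕ) : Polynomial MvP :=
  (-24 : Polynomial MvP) *
    ∑ i, ∑ k, ∑ p,
      if i < k ∧ k < p then
        Polynomial.map (MvPolynomial.C)
          ((IcovR ![Polynomial.X, Polynomial.C lam, Polynomial.C mu]
            (fun j => Polynomial.C (m i j)) (fun j => Polynomial.C (m k j))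
            (fun j => Polynomial.C (m p j))) ^ n)
        * cLin lam mu * Polynomial.C (lin (m i) * lin (m k) * lin (m p))
      else 0

/-- The nine linear forms m₁,…,m₉ (coefficient vectors). -/
def ms : Fin 9 → Fin 3 → ℂ :=
  ![![1, 3, 9], ![-10, 1, 4], ![8, 4, 6],
    ![1, 6, -10], ![4, -8, -10], ![-3, 7, -4],
    ![0, -3, 2], ![8, -4, -4], ![-10, 4, 6]]

/-- exponent function to finsupp -/
def ex (k : Fin 3 → ℕ) : Fin 3 →₀ ℕ := Finsupp.equivFunOnFinite.symm k

lemma ex_inj {k l : Fin 3 → ℕ} : ex k = ex l ↔ k = l :=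
  Finsupp.equivFunOnFinite.symm.injective.eq_iff

lemma prod_X_ex (k : Fin 3 → ℕ) : (∏ i, (X i : MvP) ^ k i) = monomial (ex k) 1 := by
  rw [monomial_eq, Finsupp.prod_fintype _ _ (by simp)]
  simp [ex]

lemma lin_pow (a : Fin 3 → ℂ) (d : ℕ) :
    lin a ^ d = ∑ k ∈ Finset.piAntidiag Finset.univ d,
      ((Nat.multinomial Finset.univ k : ℂ) * ∏ i, a i ^ k i) • (monomial (ex k) (1 : ℂ) : MvP) := by
  unfold lin
  rw [Finset.sum_pow_eq_sum_piAntidiag]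
  refine Finset.sum_congr rfl fun k _ => ?_
  rw [← prod_X_ex, smul_eq_C_mul]
  simp only [mul_pow, Finset.prod_mul_distrib, map_mul, map_prod, map_pow, map_natCast]
  ring

lemma multinomial_ne (k : Fin 3 → ℕ) : (Nat.multinomial Finset.univ k : ℂ) ≠ 0 := by
  exact_mod_cast (Nat.multinomial_pos _ _).ne'

lemma coeff_lin_pow (a : Fin 3 → ℂ) (d : ℕ) (k : Fin 3 → ℕ) (hk : ∑ i, k i = d) :
    coeff (ex k) (lin a ^ d) = (Nat.multinomial Finset.univ k : ℂ) * ∏ i, a i ^ k i := by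
  rw [lin_pow, coeff_sum, Finset.sum_eq_single k]
  · simp
  · intro l _ hl
    rw [coeff_smul, coeff_monomial, if_neg (fun h => hl (ex_inj.1 h))]
    simp
  · intro h
    exact absurd (by simp [Finset.mem_piAntidiag, hk]) h

lemma phi_zero (d : ℕ) (φ : MvP →ₗ[ℂ] ℂ) (h : ∀ a, φ (lin a ^ d) = 0)
    (k : Fin 3 → ℕ) (hk : ∑ i, k i = d) : φ (monomial (ex k) 1) = 0 := by
  set q : MvP := ∑ k ∈ Finset.piAntidiag Finset.univ d,
    monomial (ex k) ((Nat.multinomial Finset.univ k : ℂ) * φ (monomial (ex k) 1)) with hq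
  have hq0 : q = 0 := by
    apply MvPolynomial.funext
    intro a
    rw [map_zero, ← h a, lin_pow, hq, map_sum, map_sum]
    refine Finset.sum_congr rfl fun k _ => ?_
    rw [eval_monomial, map_smul, Finsupp.prod_fintype _ _ (by simp)]
    simp only [ex, Finsupp.equivFunOnFinite_symm_apply_apply, smul_eq_mul]
    ring
  have : coeff (ex k) q = (Nat.multinomial Finset.univ k : ℂ) * φ (monomial (ex k) 1) := by
    rw [hq, coeff_sum, Finset.sum_eq_single k]
    · simp
    · intro l _ hl
      rw [coeff_monomial, if_neg (fun h => hl (ex_inj.1 h))]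
    · intro h
      exact absurd (by simp [Finset.mem_piAntidiag, hk]) h
  rw [hq0, coeff_zero] at this
  exact (mul_eq_zero.1 this.symm).resolve_left (multinomial_ne k)

lemma V_le_span (d : ℕ) : V d ≤ Submodule.span ℂ (Set.range fun a => lin a ^ d) := by
  intro p hp
  by_contra hn
  obtain ⟨φ, hφ, hker⟩ := Submodule.exists_le_ker_of_notMem hn
  have h0 : ∀ a, φ (lin a ^ d) = 0 := fun a => hker (Submodule.subset_span ⟨a, rfl⟩)
  apply hφ
  rw [p.as_sum, map_sum]
  refine Finset.sum_eq_zero fun s hs => ?_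
  have hp' : p.IsHomogeneous d := hp
  have hd : s.degree = d := by
    rw [Finsupp.degree_eq_weight_one]; exact hp' (mem_support_iff.1 hs)
  have hs' : s = ex (fun i => s i) := by ext i; simp [ex]
  have := phi_zero d φ h0 (fun i => s i) (by rw [← hd, Finsupp.degree_eq_sum])
  rw [← hs'] at this
  rw [← mul_one (coeff s p), ← smul_eq_mul, ← smul_monomial, map_smul, this, smul_zero]

lemma powV_span (d : ℕ) : (⊤ : Submodule ℂ (V d)) ≤ Submodule.span ℂ (Set.range (powV d)) := by
  rintro ⟨p, hp⟩ -
  have h := V_le_span d hp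
  have : Submodule.span ℂ (Set.range fun a => lin a ^ d)
      = (Submodule.span ℂ (Set.range (powV d))).map (V d).subtype := by
    rw [Submodule.map_span, ← Set.range_comp]
    rfl
  rw [this] at h
  obtain ⟨q, hq, rfl⟩ := h
  exact hq

lemma multi_ext (d : ℕ) {W : Type*} [AddCommGroup W] [Module ℂ W]
    (f g : MultilinearMap ℂ (fun _ : Fin 4 => V d) W)
    (h : ∀ a : Fin 4 → Fin 3 → ℂ, f (fun i => powV d (a i)) = g (fun i => powV d (a i))) :
    f = g := by
  refine Module.Basis.ext_multilinear (fun _ => Module.Basis.ofSpan (powV_span d)) fun v => ?_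
  have hv : ∀ i, ∃ a, powV d a = Module.Basis.ofSpan (powV_span d) (v i) := fun i =>
    Module.Basis.ofSpan_subset (powV_span d) ⟨v i, rfl⟩
  choose a ha using hv
  simpa only [ha] using h a

/-- multihomogeneous functions of multidegree `δ` -/
def S (δ : Fin 4 → ℕ) : Submodule ℂ ((Fin 4 → Fin 3 → ℂ) → MvP) :=
  Submodule.span ℂ {F | ∃ k : Fin 4 → Fin 3 → ℕ, (∀ i, ∑ j, k i j = δ i) ∧
    ∃ v : MvP, F = fun a => C (∏ i, ∏ j, a i j ^ k i j) * v}

lemma S_mul {δ ε : Fin 4 → ℕ} {F G : (Fin 4 → Fin 3 → ℂ) → MvP} (hF : F ∈ S δ) (hG : G ∈ S ε) :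
    F * G ∈ S (δ + ε) := by
  have h := Submodule.mul_mem_mul hF hG
  unfold S at h
  rw [Submodule.span_mul_span] at h
  refine Submodule.span_mono ?_ h
  rintro _ ⟨_, ⟨k, hk, v, rfl⟩, _, ⟨l, hl, w, rfl⟩, rfl⟩
  refine ⟨k + l, fun i => by simp [Finset.sum_add_distrib, hk, hl], v * w, ?_⟩
  funext a
  simp only [Pi.mul_apply, Pi.add_apply, pow_add, Finset.prod_mul_distrib, map_mul]
  ring

lemma S_one : (1 : (Fin 4 → Fin 3 → ℂ) → MvP) ∈ S 0 :=
  Submodule.subset_span ⟨0, by simp, 1, by funext a; simp⟩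

lemma S_pow {δ : Fin 4 → ℕ} {F : (Fin 4 → Fin 3 → ℂ) → MvP} (hF : F ∈ S δ) (n : ℕ) :
    F ^ n ∈ S (n • δ) := by
  induction n with
  | zero => simpa using S_one
  | succ n ih => rw [pow_succ, succ_nsmul]; exact S_mul ih hF

lemma S_coord (i : Fin 4) (j : Fin 3) (v : MvP) :
    (fun a : Fin 4 → Fin 3 → ℂ => C (a i j) * v) ∈ S (Pi.single i 1) := by
  refine Submodule.subset_span ⟨Pi.single i (Pi.single j 1), fun i' => ?_, v, ?_⟩
  · by_cases h : i' = i
    · subst h; simp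
    · simp [h]
  · funext a
    congr 2
    rw [Finset.prod_eq_single i, Finset.prod_eq_single j]
    · simp
    · intro b _ hb; simp [hb]
    · simp
    · intro b _ hb; simp [hb]
    · simp

lemma S_lin (i : Fin 4) : (fun a : Fin 4 → Fin 3 → ℂ => lin (a i)) ∈ S (Pi.single i 1) := by
  have : (fun a : Fin 4 → Fin 3 → ℂ => lin (a i))
      = ∑ j, fun a : Fin 4 → Fin 3 → ℂ => C (a i j) * (X j : MvP) := by
    funext a; simp [lin]
  rw [this]
  exact Submodule.sum_mem _ fun j _ => S_coord i j _

lemma S_br (p q r : Fin 4) : (fun a : Fin 4 → Fin 3 → ℂ => (C (br (a p) (a q) (a r)) : MvP))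
    ∈ S (Pi.single p 1 + Pi.single q 1 + Pi.single r 1) := by
  have h : ∀ x y z : Fin 3, (fun a : Fin 4 → Fin 3 → ℂ => (C (a p x) * 1 : MvP)) *
      (fun a : Fin 4 → Fin 3 → ℂ => (C (a q y) * 1 : MvP)) *
      (fun a : Fin 4 → Fin 3 → ℂ => (C (a r z) * 1 : MvP))
      ∈ S (Pi.single p 1 + Pi.single q 1 + Pi.single r 1) := fun x y z =>
    S_mul (S_mul (S_coord p x 1) (S_coord q y 1)) (S_coord r z 1)
  have := Submodule.sub_mem _ (Submodule.add_mem _ (Submodule.add_mem _ (Submodule.sub_mem _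
    (Submodule.sub_mem _ (h 0 1 2) (h 0 2 1)) (h 1 0 2)) (h 1 2 0)) (h 2 0 1)) (h 2 1 0)
  convert this using 1
  funext a
  simp only [br, Matrix.det_fin_three, Pi.mul_apply, Pi.add_apply, Pi.sub_apply, Matrix.of_apply,
    Matrix.cons_val, map_sub, map_add, map_mul]
  ring

/-- the target function -/
def Fn (n : ℕ) (a : Fin 4 → Fin 3 → ℂ) : MvP :=
  C (Icov (a 0) (a 1) (a 2) (a 3)) ^ n *
    (lin (a 0) ^ 2 * lin (a 1) ^ 2 * lin (a 2) ^ 2 * lin (a 3) ^ 2)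

lemma Fn_mem (n : ℕ) : Fn n ∈ S (fun _ => 3 * n + 2) := by
  have h := S_mul (S_pow (S_mul (S_mul (S_mul (S_br 0 1 2) (S_br 0 1 3)) (S_br 0 2 3))
    (S_br 1 2 3)) n) (S_mul (S_mul (S_mul (S_pow (S_lin 0) 2) (S_pow (S_lin 1) 2))
      (S_pow (S_lin 2) 2)) (S_pow (S_lin 3) 2))
  convert h using 1
  · refine congrArg S ?_
    funext i
    fin_cases i <;> simp [Pi.single_apply] <;> ring
  · funext a
    simp [Fn, Icov]

/-- normalized coefficient functional -/
def cf (d : ℕ) (k : Fin 3 → ℕ) : V d →ₗ[ℂ] ℂ :=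
  (Nat.multinomial Finset.univ k : ℂ)⁻¹ • (lcoeff ℂ (ex k) ∘ₗ (V d).subtype)

lemma cf_powV (d : ℕ) (k : Fin 3 → ℕ) (hk : ∑ i, k i = d) (a : Fin 3 → ℂ) :
    cf d k (powV d a) = ∏ i, a i ^ k i := by
  simp only [cf, powV, LinearMap.smul_apply, LinearMap.comp_apply, Submodule.subtype_apply,
    lcoeff_apply, smul_eq_mul]
  rw [coeff_lin_pow a d k hk, inv_mul_cancel_left₀ (multinomial_ne k)]

lemma exists_of_mem (d : ℕ) {F : (Fin 4 → Fin 3 → ℂ) → MvP} (hF : F ∈ S (fun _ => d)) :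
    ∃ Ψ : MultilinearMap ℂ (fun _ : Fin 4 => V d) MvP,
      ∀ a, Ψ (fun i => powV d (a i)) = F a := by
  induction hF using Submodule.span_induction with
  | mem F h =>
    obtain ⟨k, hk, v, rfl⟩ := h
    refine ⟨(MultilinearMap.mkPiRing ℂ (Fin 4) v).compLinearMap fun i => cf d (k i), fun a => ?_⟩
    simp only [MultilinearMap.compLinearMap_apply, MultilinearMap.mkPiRing_apply]
    rw [smul_eq_C_mul]
    congr 2
    exact Finset.prod_congr rfl fun i _ => cf_powV d (k i) (hk i) (a i)
  | zero => exact ⟨0, fun a => rfl⟩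
  | add F G _ _ hF hG =>
    obtain ⟨Φ, h1⟩ := hF
    obtain ⟨Ψ, h2⟩ := hG
    exact ⟨Φ + Ψ, fun a => by simp [h1, h2]⟩
  | smul c F _ hF =>
    obtain ⟨Φ, h1⟩ := hF
    exact ⟨c • Φ, fun a => by simp [h1]⟩

lemma br_swap12 (a b c : Fin 3 → ℂ) : br b a c = - br a b c := by
  simp [br, Matrix.det_fin_three]; ring

lemma br_swap23 (a b c : Fin 3 → ℂ) : br a c b = - br a b c := by
  simp [br, Matrix.det_fin_three]; ring

lemma Icov12 (a b c d : Fin 3 → ℂ) : Icov b a c d = Icov a b c d := by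
  simp only [Icov, br_swap12 a b]; ring

lemma Icov23 (a b c d : Fin 3 → ℂ) : Icov a c b d = Icov a b c d := by
  simp only [Icov, br_swap23 a b c, br_swap12 b c]; ring

lemma Icov34 (a b c d : Fin 3 → ℂ) : Icov a b d c = Icov a b c d := by
  simp only [Icov, br_swap23 _ c d]; ring

lemma Fn_symm (n : ℕ) (a : Fin 4 → Fin 3 → ℂ) (σ : Equiv.Perm (Fin 4)) :
    Fn n (a ∘ σ) = Fn n a := by
  have hσ : σ ∈ Submonoid.closure
      (Set.range fun i : Fin 3 => Equiv.swap i.castSucc i.succ) := by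
    rw [Equiv.Perm.mclosure_swap_castSucc_succ]; trivial
  induction hσ using Submonoid.closure_induction generalizing a with
  | one => rfl
  | mul σ τ _ _ h1 h2 =>
    rw [Equiv.Perm.coe_mul, ← Function.comp_assoc, h2, h1]
  | mem τ h =>
    obtain ⟨i, rfl⟩ := h
    fin_cases i
    · have : ∀ i, (a ∘ (Equiv.swap (0 : Fin 4) 1)) i = ![a 1, a 0, a 2, a 3] i := by
        intro i; fin_cases i <;> rfl
      change Fn n (a ∘ (Equiv.swap (0 : Fin 4) 1)) = _
      simp only [Fn, this, Matrix.cons_val]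
      rw [Icov12]; ring
    · have : ∀ i, (a ∘ (Equiv.swap (1 : Fin 4) 2)) i = ![a 0, a 2, a 1, a 3] i := by
        intro i; fin_cases i <;> rfl
      change Fn n (a ∘ (Equiv.swap (1 : Fin 4) 2)) = _
      simp only [Fn, this, Matrix.cons_val]
      rw [Icov23]; ring
    · have : ∀ i, (a ∘ (Equiv.swap (2 : Fin 4) 3)) i = ![a 0, a 1, a 3, a 2] i := by
        intro i; fin_cases i <;> rfl
      change Fn n (a ∘ (Equiv.swap (2 : Fin 4) 3)) = _
      simp only [Fn, this, Matrix.cons_val]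
      rw [Icov34]; ring

lemma vec4 {α β : Type*} (f : α → β) (a b c d : α) :
    (![f a, f b, f c, f d] : Fin 4 → β) = fun i => f (![a, b, c, d] i) := by
  funext i; fin_cases i <;> rfl

/-- projection to degree 8 -/
def proj8 : MvP →ₗ[ℂ] V 8 :=
  (homogeneousComponent 8).codRestrict (V 8) fun p => homogeneousComponent_mem 8 p

lemma Fn_eq (n : ℕ) (a : Fin 4 → Fin 3 → ℂ) :
    Fn n a = ((Icov (a 0) (a 1) (a 2) (a 3) ^ n • prod4sq (a 0) (a 1) (a 2) (a 3) : V 8) : MvP) := by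
  rw [Submodule.coe_smul, smul_eq_C_mul, map_pow]
  rfl

lemma proj8_coe (v : V 8) : proj8 (v : MvP) = v := by
  apply Subtype.ext
  change homogeneousComponent 8 (v : MvP) = v
  rw [homogeneousComponent_of_mem v.2, if_pos rfl]

theorem stmt1 (n : ℕ) (hn : 1 ≤ n) :
    ∃! Ψ : MultilinearMap ℂ (fun _ : Fin 4 => V (3*n+2)) (V 8),
      (∀ (v : Fin 4 → V (3*n+2)) (σ : Equiv.Perm (Fin 4)), Ψ (v ∘ σ) = Ψ v) ∧
      (∀ a b c d : Fin 3 → ℂ,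
        Ψ ![powV (3*n+2) a, powV (3*n+2) b, powV (3*n+2) c, powV (3*n+2) d]
          = (Icov a b c d) ^ n • prod4sq a b c d) := by
  obtain ⟨Φ, hΦ⟩ := exists_of_mem (3*n+2) (Fn_mem n)
  have key : ∀ a : Fin 4 → Fin 3 → ℂ, proj8.compMultilinearMap Φ (fun i => powV (3*n+2) (a i))
      = Icov (a 0) (a 1) (a 2) (a 3) ^ n • prod4sq (a 0) (a 1) (a 2) (a 3) := by
    intro a
    rw [LinearMap.compMultilinearMap_apply, hΦ, Fn_eq, proj8_coe]
  refine ⟨proj8.compMultilinearMap Φ, ⟨?_, ?_⟩, ?_⟩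
  · intro v σ
    have : (proj8.compMultilinearMap Φ).domDomCongr σ = proj8.compMultilinearMap Φ := by
      apply multi_ext
      intro a
      rw [MultilinearMap.domDomCongr_apply]
      have h1 := hΦ (a ∘ σ)
      simp only [Function.comp_apply] at h1
      rw [LinearMap.compMultilinearMap_apply, LinearMap.compMultilinearMap_apply, h1, hΦ]
      exact congrArg proj8 (Fn_symm n a σ)
    exact congrArg (fun f => f v) this
  · intro a b c d
    rw [vec4 (powV (3*n+2))]
    exact key ![a, b, c, d]
  · rintro Ψ ⟨-, h⟩
    apply multi_ext
    intro a
    have ha : a = ![a 0, a 1, a 2, a 3] := by funext i; fin_cases i <;> rfl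
    have h' := h (a 0) (a 1) (a 2) (a 3)
    rw [vec4 (powV (3*n+2)), ← ha] at h'
    exact h'.trans (key a).symm
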